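/- Let s : Ω → ℝ and n : Ω → S² be smooth on an open set Ω ⊆ ℝ³ and Q = s (n⊗n − (1/3)I). Let D be the matrix field with entries D_ij = Σ_k ∂_k ∂_j Q_ik, so that ST(D)_ij = (1/2)(Σ_k ∂_k∂_j Q_ik + Σ_k ∂_k∂_i Q_jk) − (1/3) δ_ij Σ_{k,l} ∂_k∂_l Q_kl. Then ST(D) = [ (∇·n)(∇s·n) + ∇s·((∇n)n) + s (∇(∇·n))·n + ((∇²s)n)·n ] (n⊙n − (1/3)I) + n ⊙ J(s,n) + R(s,n), where J(s,n) = ((∇²s)n − (((∇²s)n)·n) n) + ((∇n)ᵀ∇s − (∇s·((∇n)n)) n) + (∇s·n)(∇n)n + (∇·n)(∇s − (∇s·n) n) + s (∇(∇·n) − ((∇(∇·n))·n) n), and R(s,n) = ST( ((∇n)n) ⊙ (∇s − (∇s·n) n) ) + (∇s·n + s ∇·n) ST(∇n) + s ST( ∇n∇n + (∇²n)n ) − (1/3)(∇²s − (1/3)(Δs) I). Moreover J(s,n)(x) is orthogonal to n(x) at every point. -/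

import Mathlib

open Real Set

noncomputable section

/-- Partial derivative in direction `i`. -/
def pd (i : Fin 3) (f : (Fin 3 → ℝ) → ℝ) (x : Fin 3 → ℝ) : ℝ :=
  fderiv ℝ f x (Pi.single i 1)

/-- Laplacian on ℝ³. -/
def lap (f : (Fin 3 → ℝ) → ℝ) (x : Fin 3 → ℝ) : ℝ :=
  ∑ i : Fin 3, pd i (fun y => pd i f y) x

/-- Kronecker delta. -/
def kron (i j : Fin 3) : ℝ := if i = j then 1 else 0

/-- Symmetric traceless part of a 3×3 matrix. -/
def stMat (A : Fin 3 → Fin 3 → ℝ) (i j : Fin 3) : ℝ :=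
  (A i j + A j i) / 2 - kron i j / 3 * (∑ k : Fin 3, A k k)

/-- Symmetrized tensor product `(u⊙v)_ij = (u_i v_j + u_j v_i)/2`. -/
def symProd (u v : Fin 3 → ℝ) (i j : Fin 3) : ℝ := (u i * v j + u j * v i) / 2

/-- The uniaxial tensor `Q = s (n ⊗ n − I/3)`. -/
def uniQ (s : (Fin 3 → ℝ) → ℝ) (n : (Fin 3 → ℝ) → Fin 3 → ℝ)
    (x : Fin 3 → ℝ) (i j : Fin 3) : ℝ :=
  s x * (n x i * n x j - kron i j / 3)

/-- Hessian `(∇²s)_ij = ∂_i ∂_j s`. -/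
def hess (s : (Fin 3 → ℝ) → ℝ) (x : Fin 3 → ℝ) (i j : Fin 3) : ℝ :=
  pd i (fun y => pd j s y) x

/-- Gradient matrix `(∇n)_ij = ∂_j n_i`. -/
def gradMat (n : (Fin 3 → ℝ) → Fin 3 → ℝ) (x : Fin 3 → ℝ) (i j : Fin 3) : ℝ :=
  pd j (fun y => n y i) x

/-- `((∇n)n)_i = Σ_k (∂_k n_i) n_k`. -/
def gradNn (n : (Fin 3 → ℝ) → Fin 3 → ℝ) (x : Fin 3 → ℝ) (i : Fin 3) : ℝ :=
  ∑ k : Fin 3, gradMat n x i k * n x k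

/-- `∇·n`. -/
def divN (n : (Fin 3 → ℝ) → Fin 3 → ℝ) (x : Fin 3 → ℝ) : ℝ :=
  ∑ k : Fin 3, pd k (fun y => n y k) x

/-- `(∇(∇·n))_i`. -/
def gradDivN (n : (Fin 3 → ℝ) → Fin 3 → ℝ) (x : Fin 3 → ℝ) (i : Fin 3) : ℝ :=
  pd i (fun y => divN n y) x

/-- `(∇n∇n)_ij = Σ_k (∂_k n_i)(∂_j n_k)`. -/
def gradNgradN (n : (Fin 3 → ℝ) → Fin 3 → ℝ) (x : Fin 3 → ℝ) (i j : Fin 3) : ℝ :=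
  ∑ k : Fin 3, gradMat n x i k * gradMat n x k j

/-- `((∇²n)n)_ij = Σ_k (∂_j ∂_k n_i) n_k`. -/
def hessNn (n : (Fin 3 → ℝ) → Fin 3 → ℝ) (x : Fin 3 → ℝ) (i j : Fin 3) : ℝ :=
  ∑ k : Fin 3, pd j (fun y => pd k (fun z => n z i) y) x * n x k

/-- `D_ij = Σ_k ∂_k ∂_j Q_ik`. -/
def Dmat (s : (Fin 3 → ℝ) → ℝ) (n : (Fin 3 → ℝ) → Fin 3 → ℝ)
    (x : Fin 3 → ℝ) (i j : Fin 3) : ℝ :=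
  ∑ k : Fin 3, pd k (fun y => pd j (fun z => uniQ s n z i k) y) x

/-- The vector field `J(s, n)` from the anisotropic decomposition. -/
def Jvec (s : (Fin 3 → ℝ) → ℝ) (n : (Fin 3 → ℝ) → Fin 3 → ℝ)
    (x : Fin 3 → ℝ) (i : Fin 3) : ℝ :=
  ((∑ j : Fin 3, hess s x i j * n x j)
      - (∑ k : Fin 3, (∑ j : Fin 3, hess s x k j * n x j) * n x k) * n x i)
    + ((∑ k : Fin 3, gradMat n x k i * pd k s x)
      - (∑ k : Fin 3, pd k s x * gradNn n x k) * n x i)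
    + (∑ k : Fin 3, pd k s x * n x k) * gradNn n x i
    + divN n x * (pd i s x - (∑ k : Fin 3, pd k s x * n x k) * n x i)
    + s x * (gradDivN n x i - (∑ k : Fin 3, gradDivN n x k * n x k) * n x i)

/-- The remainder tensor `R(s, n)` from the anisotropic decomposition. -/
def Rmat (s : (Fin 3 → ℝ) → ℝ) (n : (Fin 3 → ℝ) → Fin 3 → ℝ)
    (x : Fin 3 → ℝ) (i j : Fin 3) : ℝ :=
  stMat (fun a b =>
      symProd (gradNn n x)
        (fun c => pd c s x - (∑ k : Fin 3, pd k s x * n x k) * n x c) a b) i j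
    + ((∑ k : Fin 3, pd k s x * n x k) + s x * divN n x) * stMat (gradMat n x) i j
    + s x * stMat (fun a b => gradNgradN n x a b + hessNn n x a b) i j
    - (1/3) * (hess s x i j - (1/3) * lap s x * kron i j)

theorem Filter.EventuallyEq.pd_eq {f g : (Fin 3 → ℝ) → ℝ} {x : Fin 3 → ℝ} (h : f =ᶠ[nhds x] g)
    (i : Fin 3) : pd i f x = pd i g x := by
  simp only [pd, h.fderiv_eq]

theorem pd_add {f g : (Fin 3 → ℝ) → ℝ} {x : Fin 3 → ℝ} (hf : DifferentiableAt ℝ f x)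
    (hg : DifferentiableAt ℝ g x) (i : Fin 3) :
    pd i (fun y => f y + g y) x = pd i f x + pd i g x := by
  simp [pd, fderiv_fun_add hf hg]

theorem pd_mul {f g : (Fin 3 → ℝ) → ℝ} {x : Fin 3 → ℝ} (hf : DifferentiableAt ℝ f x)
    (hg : DifferentiableAt ℝ g x) (i : Fin 3) :
    pd i (fun y => f y * g y) x = pd i f x * g x + f x * pd i g x := by
  simp only [pd, fderiv_fun_mul hf hg, add_apply,
    smul_apply, smul_eq_mul]
  ring

theorem pd_sub_const {f : (Fin 3 → ℝ) → ℝ} {x : Fin 3 → ℝ} (c : ℝ) (i : Fin 3) :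
    pd i (fun y => f y - c) x = pd i f x := by
  simp only [pd, fderiv_sub_const]

theorem pd_sum {f : Fin 3 → (Fin 3 → ℝ) → ℝ} {x : Fin 3 → ℝ}
    (hf : ∀ k, DifferentiableAt ℝ (f k) x) (i : Fin 3) :
    pd i (fun y => ∑ k, f k y) x = ∑ k, pd i (f k) x := by
  simp [pd, fderiv_fun_sum fun k _ => hf k]

theorem ContDiffAt.pd {f : (Fin 3 → ℝ) → ℝ} {x : Fin 3 → ℝ}
    (hf : ContDiffAt ℝ (⊤ : ℕ∞) f x) (i : Fin 3) :
    ContDiffAt ℝ (⊤ : ℕ∞) (fun y => pd i f y) x :=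
  (hf.fderiv_right (m := (⊤ : ℕ∞)) (by exact_mod_cast le_rfl)).clm_apply contDiffAt_const

theorem pd_comm {f : (Fin 3 → ℝ) → ℝ} {x : Fin 3 → ℝ}
    (hf : ContDiffAt ℝ (⊤ : ℕ∞) f x) (i j : Fin 3) :
    pd i (fun y => pd j f y) x = pd j (fun y => pd i f y) x := by
  have hd : DifferentiableAt ℝ (fderiv ℝ f) x :=
    (hf.fderiv_right (m := 1) (by norm_cast)).differentiableAt (by simp)
  have hsymm := (hf.isSymmSndFDerivAt (by simp; norm_cast)).eq (Pi.single i 1) (Pi.single j 1)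
  simpa [pd, fderiv_clm_apply hd (differentiableAt_const _)] using hsymm

/-- Second-order Leibniz rule for the entries of a uniaxial tensor. -/
theorem pd_pd_mul_mul_sub_const {s u v : (Fin 3 → ℝ) → ℝ} {x : Fin 3 → ℝ}
    (hs : ContDiffAt ℝ (⊤ : ℕ∞) s x) (hu : ContDiffAt ℝ (⊤ : ℕ∞) u x)
    (hv : ContDiffAt ℝ (⊤ : ℕ∞) v x) (c : ℝ) (k j : Fin 3) :
    pd k (fun y => pd j (fun z => s z * (u z * v z - c)) y) x
      = pd k (fun y => pd j s y) x * (u x * v x - c)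
        + pd j s x * (pd k u x * v x + u x * pd k v x)
        + pd k s x * (pd j u x * v x + u x * pd j v x)
        + s x * (pd k (fun y => pd j u y) x * v x + pd j u x * pd k v x
          + (pd k u x * pd j v x + u x * pd k (fun y => pd j v y) x)) := by
  have diff {f : (Fin 3 → ℝ) → ℝ} {y : Fin 3 → ℝ} (h : ContDiffAt ℝ (⊤ : ℕ∞) f y) :
      DifferentiableAt ℝ f y := h.differentiableAt (by simp)
  have hfst : (fun y => pd j (fun z => s z * (u z * v z - c)) y) =ᶠ[nhds x]
      fun y => pd j s y * (u y * v y - c) + s y * (pd j u y * v y + u y * pd j v y) := by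
    have key {f : (Fin 3 → ℝ) → ℝ} (h : ContDiffAt ℝ (⊤ : ℕ∞) f x) :
        ∀ᶠ y in nhds x, DifferentiableAt ℝ f y :=
      ((h.of_le (m := 1) (by norm_cast)).eventually (by simp)).mono
        fun y hy => hy.differentiableAt (by simp)
    filter_upwards [key hs, key hu, key hv] with y hsy huy hvy
    rw [pd_mul hsy ((huy.fun_mul hvy).sub_const c), pd_sub_const, pd_mul huy hvy]
  have ds := diff hs
  have du := diff hu
  have dv := diff hv
  have ds' := diff (hs.pd j)
  have du' := diff (hu.pd j)
  have dv' := diff (hv.pd j)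
  have duv := (du.fun_mul dv).sub_const c
  have duv' := (du'.fun_mul dv).fun_add (du.fun_mul dv')
  rw [hfst.pd_eq, pd_add (ds'.fun_mul duv) (ds.fun_mul duv'), pd_mul ds' duv, pd_mul ds duv',
    pd_sub_const, pd_mul du dv, pd_add (du'.fun_mul dv) (du.fun_mul dv'), pd_mul du' dv,
    pd_mul du dv']
  ring

theorem hess_comm {s : (Fin 3 → ℝ) → ℝ} {x : Fin 3 → ℝ}
    (hs : ContDiffAt ℝ (⊤ : ℕ∞) s x) (i j : Fin 3) : hess s x i j = hess s x j i :=
  pd_comm hs i j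

theorem gradDivN_eq_sum {n : (Fin 3 → ℝ) → Fin 3 → ℝ} {x : Fin 3 → ℝ}
    (hn : ∀ i, ContDiffAt ℝ (⊤ : ℕ∞) (fun y => n y i) x) (j : Fin 3) :
    gradDivN n x j = ∑ k, pd k (fun y => pd j (fun z => n z k) y) x := by
  unfold gradDivN divN
  rw [pd_sum fun k => ((hn k).pd k).differentiableAt (by simp)]
  exact Finset.sum_congr rfl fun k _ => pd_comm (hn k) j k

theorem Dmat_eq {s : (Fin 3 → ℝ) → ℝ} {n : (Fin 3 → ℝ) → Fin 3 → ℝ} {x : Fin 3 → ℝ}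
    (hs : ContDiffAt ℝ (⊤ : ℕ∞) s x) (hn : ∀ i, ContDiffAt ℝ (⊤ : ℕ∞) (fun y => n y i) x)
    (i j : Fin 3) :
    Dmat s n x i j
      = n x i * (∑ k, hess s x j k * n x k) - hess s x i j / 3
        + pd j s x * (gradNn n x i + n x i * divN n x)
        + (∑ k, pd k s x * n x k) * gradMat n x i j
        + n x i * (∑ k, gradMat n x k j * pd k s x)
        + s x * (hessNn n x i j + divN n x * gradMat n x i j + gradNgradN n x i j
          + n x i * gradDivN n x j) := by
  have hkron : ∑ k, hess s x k j * kron i k = hess s x i j := by simp [kron]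
  have hterm (k : Fin 3) := pd_pd_mul_mul_sub_const hs (hn i) (hn k) (kron i k / 3) k j
  simp only [Dmat, uniQ, hterm, gradDivN_eq_sum hn, hessNn, pd_comm (hn i) j, ← hkron,
    hess_comm hs j]
  simp only [hess, gradMat, gradNn, divN, gradNgradN, Fin.sum_univ_three]
  ring

theorem sum_gradNn_mul_eq_zero {n : (Fin 3 → ℝ) → Fin 3 → ℝ} {x : Fin 3 → ℝ}
    (hn : ∀ i, DifferentiableAt ℝ (fun y => n y i) x)
    (hunit : ∀ᶠ y in nhds x, ∑ i, n y i ^ 2 = 1) : ∑ i, gradNn n x i * n x i = 0 := by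
  have hpd (k : Fin 3) : ∑ i, gradMat n x i k * n x i = 0 := by
    have hconst : (fun y => ∑ i, n y i * n y i) =ᶠ[nhds x] fun _ => 1 := by
      filter_upwards [hunit] with y hy
      simpa only [pow_two] using hy
    have h := hconst.pd_eq k
    rw [pd_sum fun i => (hn i).fun_mul (hn i)] at h
    simp only [pd_mul (hn _) (hn _), Fin.sum_univ_three] at h
    simp only [pd, fderiv_fun_const, Pi.zero_apply, zero_apply] at h
    simp only [gradMat, pd, Fin.sum_univ_three]
    linear_combination h / 2
  have h0 := hpd 0
  have h1 := hpd 1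
  have h2 := hpd 2
  simp only [gradNn, Fin.sum_univ_three] at *
  linear_combination n x 0 * h0 + n x 1 * h1 + n x 2 * h2

/-- decomposition of the symmetric traceless part of
`D_ij = Σ_k ∂_k ∂_j Q_ik` for a uniaxial `Q = s(n⊗n − I/3)`:
`ST(D) = [⋯](n⊙n − I/3) + n ⊙ J(s,n) + R(s,n)` with `J(s,n) ⟂ n` pointwise. -/
theorem stmt15 (Ω : Set (Fin 3 → ℝ)) (hΩ : IsOpen Ω)
    (s : (Fin 3 → ℝ) → ℝ) (n : (Fin 3 → ℝ) → Fin 3 → ℝ)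
    (hs : ContDiffOn ℝ (⊤ : ℕ∞) s Ω)
    (hn : ContDiffOn ℝ (⊤ : ℕ∞) n Ω)
    (hunit : ∀ x ∈ Ω, ∑ i : Fin 3, n x i ^ 2 = 1) :
    ∀ x ∈ Ω,
      (∀ i j : Fin 3,
        stMat (Dmat s n x) i j
          = (divN n x * (∑ k : Fin 3, pd k s x * n x k)
              + (∑ k : Fin 3, pd k s x * gradNn n x k)
              + s x * (∑ k : Fin 3, gradDivN n x k * n x k)
              + (∑ k : Fin 3, (∑ l : Fin 3, hess s x k l * n x l) * n x k))
              * (symProd (n x) (n x) i j - kron i j / 3)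
            + symProd (n x) (Jvec s n x) i j
            + Rmat s n x i j)
      ∧ (∑ i : Fin 3, Jvec s n x i * n x i = 0) := by
  intro x hx
  have hΩx : Ω ∈ nhds x := hΩ.mem_nhds hx
  have hsx : ContDiffAt ℝ (⊤ : ℕ∞) s x := hs.contDiffAt hΩx
  have hnx : ∀ i, ContDiffAt ℝ (⊤ : ℕ∞) (fun y => n y i) x :=
    contDiffAt_pi.1 (hn.contDiffAt hΩx)
  have horth := sum_gradNn_mul_eq_zero (fun i => (hnx i).differentiableAt (by simp))
    (Filter.eventually_of_mem hΩx hunit)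
  have hgrad : ∑ k, (∑ l, gradMat n x l k * pd l s x) * n x k
      = ∑ k, pd k s x * gradNn n x k := by
    simp only [gradNn, Fin.sum_univ_three]
    ring
  constructor
  · intro i j
    have hlap : lap s x = ∑ k, hess s x k k := rfl
    have hdiv : divN n x = ∑ k, gradMat n x k k := rfl
    have hsymm := hess_comm hsx j i
    simp only [stMat, symProd, Rmat, Jvec, Dmat_eq hsx hnx, hlap]
    simp only [Fin.sum_univ_three] at *
    linear_combination (-kron i j / 3) * hgrad - hsymm / 6
      - kron i j / 3 * (pd 0 s x * n x 0 + pd 1 s x * n x 1 + pd 2 s x * n x 2) * horth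
  · have hone := hunit x hx
    set H := ∑ k, (∑ j, hess s x k j * n x j) * n x k with hH
    set a := ∑ k, pd k s x * n x k with ha
    set b := ∑ k, pd k s x * gradNn n x k with hb
    set c := ∑ k, gradDivN n x k * n x k with hc
    calc ∑ i, Jvec s n x i * n x i
        = ∑ i, ((∑ j, hess s x i j * n x j) * n x i
            + (∑ k, gradMat n x k i * pd k s x) * n x i
            + a * (gradNn n x i * n x i) + divN n x * (pd i s x * n x i)
            + s x * (gradDivN n x i * n x i) - (H + b + divN n x * a + s x * c) * n x i ^ 2) :=
          Finset.sum_congr rfl fun i _ => by simp only [Jvec, ← hH, ← ha, ← hb, ← hc]; ring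
      _ = 0 := by
          simp only [Finset.sum_add_distrib, Finset.sum_sub_distrib, ← Finset.mul_sum, hgrad,
            horth, hone, ← hH, ← ha, ← hc]
          ring

end
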